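/- arXiv:1910.04260 — 8 statements merged into one kernel-verified Lean document; each statement's English description precedes it below -/
import Mathlib

section
/- For every inverse-demand function V and every cost function C, the regulator's complete-information payoff equals the social optimum: the supremum, over all policies ρ and all firm's best responses (q,p) to (V,C) under ρ, of CS + α·FP equals OPT(V,C), and this supremum is attained by some policy and some best response. -/
open Real Set MeasureTheory

noncomputable section

/-- `V` is an inverse-demand function: antitone, upper-semicontinuous, with values in `[0, vbar]`. -/
def IsDemand (vbar : ℝ) (V : ℝ → ℝ) : Prop :=
  AntitoneOn V (Icc 0 1) ∧ UpperSemicontinuousOn V (Icc 0 1) ∧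
    ∀ z ∈ Icc (0:ℝ) 1, V z ∈ Icc 0 vbar

/-- `C` is a cost function: monotone increasing, lower-semicontinuous, nonnegative, `C 0 = 0`. -/
def IsCost (C : ℝ → ℝ) : Prop :=
  MonotoneOn C (Icc 0 1) ∧ LowerSemicontinuousOn C (Icc 0 1) ∧
    (∀ z ∈ Icc (0:ℝ) 1, 0 ≤ C z) ∧ C 0 = 0

/-- `(q, p)` is feasible under the inverse-demand function `V`. -/
def Feasible (vbar : ℝ) (V : ℝ → ℝ) (q p : ℝ) : Prop :=
  q ∈ Icc (0:ℝ) 1 ∧ p ∈ Icc (0:ℝ) vbar ∧ p ≤ V q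

/-- The social optimum `OPT(V, C)`. -/
def OPT (V C : ℝ → ℝ) : ℝ :=
  sSup { x | ∃ q ∈ Icc (0:ℝ) 1, x = (∫ z in (0:ℝ)..q, V z) - C q }

/-- `ρ` is a policy: upper-semicontinuous with `ρ 0 0 ≥ 0`. -/
def IsPolicy (vbar : ℝ) (ρ : ℝ → ℝ → ℝ) : Prop :=
  UpperSemicontinuousOn (fun x : ℝ × ℝ => ρ x.1 x.2) (Icc 0 1 ×ˢ Icc 0 vbar) ∧ 0 ≤ ρ 0 0

/-- `(q, p)` is a firm's best response to `(V, C)` under the policy `ρ`. -/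
def BestResponse (vbar : ℝ) (V C : ℝ → ℝ) (ρ : ℝ → ℝ → ℝ) (q p : ℝ) : Prop :=
  Feasible vbar V q p ∧
    ∀ q' p', Feasible vbar V q' p' → ρ q' p' - C q' ≤ ρ q p - C q

/-- The regret `RGRT = DSTR + (1 - α) * FP`. -/
def RGRT (vbar α : ℝ) (V C : ℝ → ℝ) (ρ : ℝ → ℝ → ℝ) (q p : ℝ) : ℝ :=
  (OPT V C - ((∫ z in (0:ℝ)..q, V z) - C q)) + (1 - α) * (ρ q p - C q)

/-- The worst-case regret of a policy `ρ` (as an extended real, since the supremum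
ranges over all demand/cost scenarios and best responses). -/
def WCR (vbar α : ℝ) (ρ : ℝ → ℝ → ℝ) : EReal :=
  sSup { r : EReal | ∃ V C q p, IsDemand vbar V ∧ IsCost C ∧
    BestResponse vbar V C ρ q p ∧ r = ((RGRT vbar α V C ρ q p : ℝ) : EReal) }

/-- The price-cap level `k_α = v̄ / (2 - α)`. -/
def kcap (vbar α : ℝ) : ℝ := vbar / (2 - α)

/-- The objective `min((1-α) q k_α - q p log q, q (k_α - p))`.
(Note `Real.log 0 = 0`, so `q * p * log q` is `0` at `q = 0` as required.) -/
def regretFn (vbar α q p : ℝ) : ℝ :=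
  min ((1 - α) * q * kcap vbar α - q * p * Real.log q) (q * (kcap vbar α - p))

/-- The lower bound `r_α` on the worst-case regret. -/
def rbound (vbar α : ℝ) : ℝ :=
  sSup { x | ∃ q ∈ Icc (0:ℝ) 1, ∃ p ∈ Icc (0:ℝ) (kcap vbar α), x = regretFn vbar α q p }

/-- The subsidy level `s_α`. (`Real.sSup ∅ = 0`, matching the convention for the empty set.) -/
def sbound (vbar α : ℝ) : ℝ :=
  sSup { x | ∃ q ∈ Icc (0:ℝ) 1, ∃ p ∈ Icc (0:ℝ) (kcap vbar α),
    (1 - α) * q * kcap vbar α - q * p * Real.log q > rbound vbar α ∧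
      x = q * (kcap vbar α - p) }


lemma IsDemand.intervalIntegrable {vbar : ℝ} {V : ℝ → ℝ} (hV : IsDemand vbar V) :
    IntervalIntegrable V volume 0 1 :=
  AntitoneOn.intervalIntegrable (by simpa [uIcc_of_le zero_le_one] using hV.1)

/-- The social surplus is upper-semicontinuous in the quantity. -/
lemma upperSemicontinuousOn_surplus {vbar : ℝ} {V C : ℝ → ℝ}
    (hV : IsDemand vbar V) (hC : IsCost C) :
    UpperSemicontinuousOn (fun q => (∫ z in (0:ℝ)..q, V z) - C q) (Icc 0 1) := by
  have hint : ContinuousOn (fun q => ∫ z in (0:ℝ)..q, V z) (Icc 0 1) := by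
    have h := intervalIntegral.continuousOn_primitive_interval (μ := volume) (f := V)
      (a := 0) (b := 1) ((intervalIntegrable_iff').1 hV.intervalIntegrable)
    simpa [uIcc_of_le zero_le_one] using h
  have hneg : UpperSemicontinuousOn (fun q => -C q) (Icc 0 1) := by
    intro q hq y hy
    filter_upwards [hC.2.1 q hq (-y) (by linarith)] with q' hq'
    linarith
  simpa only [sub_eq_add_neg] using hint.upperSemicontinuousOn.add hneg

/-- The social optimum is attained. -/
lemma isGreatest_OPT {vbar : ℝ} {V C : ℝ → ℝ} (hV : IsDemand vbar V) (hC : IsCost C) :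
    IsGreatest { x | ∃ q ∈ Icc (0:ℝ) 1, x = (∫ z in (0:ℝ)..q, V z) - C q } (OPT V C) := by
  obtain ⟨q, hq, hmax⟩ := (upperSemicontinuousOn_surplus hV hC).exists_isMaxOn
    (nonempty_Icc.2 zero_le_one) isCompact_Icc
  have h : IsGreatest { x | ∃ q ∈ Icc (0:ℝ) 1, x = (∫ z in (0:ℝ)..q, V z) - C q }
      ((∫ z in (0:ℝ)..q, V z) - C q) := by
    refine ⟨⟨q, hq, rfl⟩, ?_⟩
    rintro x ⟨q', hq', rfl⟩
    exact hmax hq'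
  rwa [OPT, h.csSup_eq]

/-- Paying a fixed nonnegative amount exactly at the quantity `q₀` is a policy. -/
lemma isPolicy_targetPayment (vbar q₀ : ℝ) {c : ℝ} (hc : 0 ≤ c) :
    IsPolicy vbar (fun q _ => if q = q₀ then c else 0) := by
  refine ⟨?_, by dsimp only; split_ifs <;> simp [hc]⟩
  have hclosed : IsClosed {x : ℝ × ℝ | x.1 = q₀} := isClosed_eq continuous_fst continuous_const
  have h := (hclosed.upperSemicontinuous_indicator hc).upperSemicontinuousOn
    (Icc 0 1 ×ˢ Icc 0 vbar)
  convert h using 2 with x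
  simp [indicator]

/-- The firm never makes a loss at a best response, since it may stay out of the market. -/
lemma BestResponse.profit_nonneg {vbar : ℝ} {V C : ℝ → ℝ} {ρ : ℝ → ℝ → ℝ} {q p : ℝ}
    (hv : 0 ≤ vbar) (hV : IsDemand vbar V) (hC : IsCost C) (hρ : IsPolicy vbar ρ)
    (h : BestResponse vbar V C ρ q p) : 0 ≤ ρ q p - C q := by
  have h0 : (0:ℝ) ∈ Icc (0:ℝ) 1 := ⟨le_rfl, zero_le_one⟩
  have := h.2 0 0 ⟨h0, ⟨le_rfl, hv⟩, (hV.2.2 0 h0).1⟩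
  linarith [hρ.2, hC.2.2.2]

/-- Under complete information, for every inverse-demand function `V` and cost
function `C`, the supremum over all policies `rho` and firm's best responses `(q, p)` of
`CS + alpha * FP` equals `OPT (V, C)`, and the supremum is attained by some policy and some
best response. -/
theorem complete_information_payoff_eq_OPT
    (vbar alpha : ℝ) (hv : 0 < vbar) (halpha : alpha ∈ Icc (0:ℝ) 1)
    (V C : ℝ → ℝ) (hV : IsDemand vbar V) (hC : IsCost C) :
    IsGreatest { x | ∃ ρ q p, IsPolicy vbar ρ ∧ BestResponse vbar V C ρ q p ∧
      x = ((∫ z in (0:ℝ)..q, V z) - ρ q p) + alpha * (ρ q p - C q) } (OPT V C) := by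
  constructor
  · obtain ⟨q, hq, hopt⟩ := (isGreatest_OPT hV hC).1
    refine ⟨fun q' _ => if q' = q then C q else 0, q, 0,
      isPolicy_targetPayment vbar q (hC.2.2.1 q hq),
      ⟨⟨hq, ⟨le_rfl, hv.le⟩, (hV.2.2 q hq).1⟩, ?_⟩, by simp [hopt]⟩
    intro q' p' hfeas
    have := hC.2.2.1 q' hfeas.1
    dsimp only
    split_ifs with h
    · rw [h]
    all_goals simp_all
  · rintro x ⟨ρ, q, p, hρ, hbr, rfl⟩
    have hsurplus := (isGreatest_OPT hV hC).2 ⟨q, hbr.1.1, rfl⟩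
    have hprofit := hbr.profit_nonneg hv.le hV hC hρ
    nlinarith [mul_nonneg (sub_nonneg.2 halpha.2) hprofit]
end
end

section
/- For every policy ρ, the worst-case regret satisfies WCR(ρ) ≥ r_α, where r_α = sup_{q∈[0,1], p∈[0,k_α]} min( (1−α)·q·k_α − q·p·log q , q·(k_α − p) ) (with q·p·log q interpreted as 0 at q = 0). -/
open Real Set MeasureTheory

noncomputable section

/-- Demand equal to `a` up to `c` and to `f` beyond `c`. -/
def stepDemand (c a : ℝ) (f : ℝ → ℝ) (z : ℝ) : ℝ := if z ≤ c then a else f z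

/-- A fixed cost `R`, paid for every positive quantity. -/
def fixedCost (R : ℝ) (z : ℝ) : ℝ := if z ≤ 0 then 0 else R

theorem isDemand_stepDemand {vbar c a : ℝ} {f : ℝ → ℝ} (ha : a ∈ Icc 0 vbar)
    (hf : AntitoneOn f (Ioi c)) (hfc : ContinuousOn f (Ioi c))
    (hfa : ∀ z, c < z → f z ∈ Icc 0 a) : IsDemand vbar (stepDemand c a f) := by
  have hle : ∀ z, stepDemand c a f z ≤ a := by
    intro z
    unfold stepDemand
    split_ifs with h
    · exact le_rfl
    · exact (hfa z (not_le.1 h)).2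
  refine ⟨?_, ?_, ?_⟩
  · intro x _ y _ hxy
    by_cases hx : x ≤ c
    · simpa [stepDemand, hx] using hle y
    · have hy : ¬ y ≤ c := fun h => hx (hxy.trans h)
      simpa [stepDemand, hx, hy] using hf (not_le.1 hx) (not_le.1 hy) hxy
  · intro x _ y hy
    by_cases hx : x ≤ c
    · simp only [stepDemand, hx, if_true] at hy
      exact Filter.Eventually.of_forall fun z => (hle z).trans_lt hy
    · rw [not_le] at hx
      simp only [stepDemand, not_le.2 hx, if_false] at hy
      have h1 : ∀ᶠ z in nhds x, f z < y :=
        (hfc.continuousAt (Ioi_mem_nhds hx)).eventually (gt_mem_nhds hy)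
      refine Filter.Eventually.filter_mono nhdsWithin_le_nhds ?_
      filter_upwards [h1, Ioi_mem_nhds hx] with z hz hzc
      simpa [stepDemand, not_le.2 (mem_Ioi.1 hzc)] using hz
  · intro z _
    refine ⟨?_, (hle z).trans ha.2⟩
    unfold stepDemand
    split_ifs with h
    · exact ha.1
    · exact (hfa z (not_le.1 h)).1

theorem isCost_fixedCost {R : ℝ} (hR : 0 ≤ R) : IsCost (fixedCost R) := by
  have h0 : ∀ z, 0 ≤ fixedCost R z := by
    intro z
    unfold fixedCost
    split_ifs <;> simp [hR]
  refine ⟨?_, ?_, fun z _ => h0 z, by simp [fixedCost]⟩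
  · intro x _ y _ hxy
    by_cases hx : x ≤ 0
    · simpa [fixedCost, hx] using h0 y
    · have hy : ¬ y ≤ 0 := fun h => hx (hxy.trans h)
      simp [fixedCost, hx, hy]
  · intro x _ y hy
    by_cases hx : x ≤ 0
    · simp only [fixedCost, hx, if_true] at hy
      exact Filter.Eventually.of_forall fun z => hy.trans_le (h0 z)
    · rw [not_le] at hx
      simp only [fixedCost, not_le.2 hx, if_false] at hy
      refine Filter.Eventually.filter_mono nhdsWithin_le_nhds ?_
      filter_upwards [Ioi_mem_nhds hx] with z hz
      simpa [fixedCost, not_le.2 (mem_Ioi.1 hz)] using hy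

theorem integral_le_mul_of_demand_le {V : ℝ → ℝ} {q a : ℝ} (hq : 0 ≤ q)
    (hV : ∀ z ∈ Ioc 0 q, V z ∈ Icc 0 a) : ∫ z in (0:ℝ)..q, V z ≤ a * q := by
  have h := intervalIntegral.norm_integral_le_of_norm_le_const (f := V) (a := 0) (b := q) (C := a)
    (by
      intro z hz
      rw [uIoc_of_le hq] at hz
      rw [Real.norm_of_nonneg (hV z hz).1]
      exact (hV z hz).2)
  rw [sub_zero, abs_of_nonneg hq] at h
  exact (le_abs_self _).trans h

theorem le_OPT {vbar : ℝ} {V C : ℝ → ℝ} (hV : IsDemand vbar V) (hC : IsCost C) {q : ℝ}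
    (hq : q ∈ Icc (0:ℝ) 1) : (∫ z in (0:ℝ)..q, V z) - C q ≤ OPT V C := by
  refine le_csSup ⟨vbar, ?_⟩ ⟨q, hq, rfl⟩
  rintro _ ⟨x, hx, rfl⟩
  have h0 := hV.2.2 0 (by simp)
  have h1 := integral_le_mul_of_demand_le (V := V) hx.1
    (fun z hz => hV.2.2 z ⟨hz.1.le, hz.2.trans hx.2⟩)
  nlinarith [hC.2.2.1 x hx, h0.1.trans h0.2, hx.2]

/-- Above `q`, demand follows the hyperbola of revenue `q * p`; below `q` it is maximal. -/
def hyperbolicDemand (vbar q p : ℝ) : ℝ → ℝ := stepDemand q vbar fun z => q * p / z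

theorem isDemand_hyperbolicDemand {vbar q p : ℝ} (hv : 0 ≤ vbar) (hq : 0 ≤ q)
    (hp : p ∈ Icc 0 vbar) : IsDemand vbar (hyperbolicDemand vbar q p) := by
  have hqp : 0 ≤ q * p := mul_nonneg hq hp.1
  refine isDemand_stepDemand ⟨hv, le_rfl⟩ ?_ ?_ ?_
  · intro x hx y _ hxy
    exact div_le_div_of_nonneg_left hqp (hq.trans_lt hx) hxy
  · exact continuousOn_const.div continuousOn_id fun z hz => (hq.trans_lt hz).ne'
  · intro z hz
    have hz0 : 0 < z := hq.trans_lt hz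
    refine ⟨by positivity, ?_⟩
    rw [div_le_iff₀ hz0]
    nlinarith [hp.1, hp.2]

theorem integral_hyperbolicDemand {vbar q p : ℝ} (hv : 0 ≤ vbar) (hq : q ∈ Icc (0:ℝ) 1)
    (hp : p ∈ Icc 0 vbar) :
    ∫ z in (0:ℝ)..1, hyperbolicDemand vbar q p z = vbar * q - q * p * Real.log q := by
  have hanti := (isDemand_hyperbolicDemand hv hq.1 hp).1
  have hintegral : ∀ a b : ℝ, a ∈ Icc (0:ℝ) 1 → b ∈ Icc (0:ℝ) 1 →
      IntervalIntegrable (hyperbolicDemand vbar q p) volume a b := fun a b ha hb =>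
    (hanti.mono (uIcc_subset_Icc ha hb)).intervalIntegrable
  rw [← intervalIntegral.integral_add_adjacent_intervals
    (hintegral 0 q (by simp) hq) (hintegral q 1 hq (by simp))]
  have h1 : ∫ z in (0:ℝ)..q, hyperbolicDemand vbar q p z = ∫ _ in (0:ℝ)..q, vbar := by
    refine intervalIntegral.integral_congr_ae (Filter.Eventually.of_forall fun z hz => ?_)
    rw [uIoc_of_le hq.1] at hz
    simp [hyperbolicDemand, stepDemand, hz.2]
  have h2 : ∫ z in q..1, hyperbolicDemand vbar q p z = ∫ z in q..1, q * p * z⁻¹ := by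
    refine intervalIntegral.integral_congr_ae (Filter.Eventually.of_forall fun z hz => ?_)
    rw [uIoc_of_le hq.2] at hz
    simp [hyperbolicDemand, stepDemand, not_le.2 hz.1, div_eq_mul_inv]
  rw [h1, h2, intervalIntegral.integral_const_mul, intervalIntegral.integral_const]
  rcases hq.1.eq_or_lt with h | h
  · simp [← h]
  · rw [integral_inv_of_pos h one_pos, one_div, Real.log_inv]
    simp
    ring

theorem isCompact_feasible_hyperbolicDemand {vbar q p : ℝ} (hq : q ∈ Icc (0:ℝ) 1) :
    IsCompact {x : ℝ × ℝ | Feasible vbar (hyperbolicDemand vbar q p) x.1 x.2} := by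
  have heq : {x : ℝ × ℝ | Feasible vbar (hyperbolicDemand vbar q p) x.1 x.2} =
      (Icc 0 1 ×ˢ Icc 0 vbar) ∩ ({x | x.1 ≤ q} ∪ {x | q ≤ x.1 ∧ x.1 * x.2 ≤ q * p}) := by
    ext ⟨z, r⟩
    simp only [Feasible, hyperbolicDemand, stepDemand, mem_ofPred_eq, mem_inter_iff, mem_prod,
      mem_union, and_assoc]
    refine and_congr_right fun hz => and_congr_right fun hr => ?_
    by_cases h : z ≤ q
    · simp [h, hr.2]
    · have hz0 : 0 < z := hq.1.trans_lt (not_le.1 h)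
      simp [h, (not_le.1 h).le, le_div_iff₀ hz0, mul_comm]
  rw [heq]
  refine (isCompact_Icc.prod isCompact_Icc).inter_right (IsClosed.union ?_ (IsClosed.inter ?_ ?_))
  · exact isClosed_le continuous_fst continuous_const
  · exact isClosed_le continuous_const continuous_fst
  · exact isClosed_le (continuous_fst.mul continuous_snd) continuous_const

theorem le_WCR {vbar α x : ℝ} {ρ : ℝ → ℝ → ℝ} {V C : ℝ → ℝ} {q p : ℝ} (hV : IsDemand vbar V)
    (hC : IsCost C) (h : BestResponse vbar V C ρ q p) (hx : x ≤ RGRT vbar α V C ρ q p) :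
    (x : EReal) ≤ WCR vbar α ρ :=
  (EReal.coe_le_coe_iff.2 hx).trans (le_sSup ⟨V, C, q, p, hV, hC, h, rfl⟩)

theorem regretFn_le_WCR {vbar α : ℝ} (hv : 0 < vbar) (hα : α ∈ Icc (0:ℝ) 1)
    {ρ : ℝ → ℝ → ℝ} (hρ : IsPolicy vbar ρ) {q p : ℝ} (hq : q ∈ Icc (0:ℝ) 1)
    (hp : p ∈ Icc (0:ℝ) (kcap vbar α)) :
    ((regretFn vbar α q p : ℝ) : EReal) ≤ WCR vbar α ρ := by
  obtain ⟨hα0, hα1⟩ := hα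
  have hk : (2 - α) * kcap vbar α = vbar := by
    unfold kcap
    field_simp [show (2 - α) ≠ 0 by linarith]
  have hvq : vbar * q = (2 - α) * kcap vbar α * q := by rw [hk]
  have hk0 : 0 ≤ kcap vbar α := hp.1.trans hp.2
  have hpv : p ∈ Icc 0 vbar := ⟨hp.1, by nlinarith [hp.2]⟩
  have hV := isDemand_hyperbolicDemand hv.le hq.1 hpv
  have hintegral := integral_hyperbolicDemand hv.le hq hpv
  have hcomp := isCompact_feasible_hyperbolicDemand (vbar := vbar) (p := p) hq
  have hV0 : hyperbolicDemand vbar q p 0 = vbar := by simp [hyperbolicDemand, stepDemand, hq.1]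
  have hfeas0 : ∀ r ∈ Icc 0 vbar, Feasible vbar (hyperbolicDemand vbar q p) 0 r := fun r hr =>
    ⟨by simp, hr, by simpa [hV0] using hr.2⟩
  obtain ⟨⟨q₁, p₁⟩, hf₁, hmax₁⟩ := UpperSemicontinuousOn.exists_isMaxOn
    (f := fun x : ℝ × ℝ => ρ x.1 x.2) ⟨(0, 0), hfeas0 0 (by simp [hv.le])⟩ hcomp
    (hρ.1.mono fun x hx => ⟨hx.1, hx.2.1⟩)
  obtain ⟨⟨q₀, p₀⟩, hf₀, hmax₀⟩ := UpperSemicontinuousOn.exists_isMaxOn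
    (s := {(0:ℝ)} ×ˢ Icc 0 vbar) (f := fun x : ℝ × ℝ => ρ x.1 x.2)
    ⟨(0, 0), by simp [hv.le]⟩ (isCompact_singleton.prod isCompact_Icc)
    (hρ.1.mono (prod_mono (by simp) subset_rfl))
  obtain ⟨h₀, hp₀⟩ := hf₀
  obtain rfl : q₀ = 0 := h₀
  have hle₁ : ∀ q' p', Feasible vbar (hyperbolicDemand vbar q p) q' p' → ρ q' p' ≤ ρ q₁ p₁ :=
    fun q' p' h => hmax₁ (a := (q', p')) h
  have hle₀ : ∀ r ∈ Icc 0 vbar, ρ 0 r ≤ ρ 0 p₀ := fun r hr => hmax₀ (a := (0, r)) ⟨rfl, hr⟩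
  have hM0 : 0 ≤ ρ 0 p₀ := hρ.2.trans (hle₀ 0 (by simp [hv.le]))
  have hR : 0 ≤ ρ q₁ p₁ - ρ 0 p₀ := sub_nonneg.2 (hle₁ 0 p₀ (hfeas0 p₀ hp₀))
  have hprofit : ∀ q' p', Feasible vbar (hyperbolicDemand vbar q p) q' p' →
      ρ q' p' - fixedCost (ρ q₁ p₁ - ρ 0 p₀) q' ≤ ρ 0 p₀ := by
    intro q' p' h
    by_cases hq' : q' ≤ 0
    · obtain rfl : q' = 0 := le_antisymm hq' h.1.1
      simpa [fixedCost] using hle₀ p' h.2.1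
    · simp only [fixedCost, hq', if_false]
      linarith [hle₁ q' p' h]
  have hC := isCost_fixedCost hR
  by_cases hlow : ρ q₁ p₁ - ρ 0 p₀ < q * kcap vbar α
  · refine le_WCR hV hC (q := 0) (p := p₀) ⟨hfeas0 p₀ hp₀, fun q' p' h => ?_⟩
      ((min_le_left _ _).trans ?_)
    · simpa [fixedCost] using hprofit q' p' h
    · have hopt := le_OPT hV hC (q := 1) (by simp)
      rw [hintegral] at hopt
      simp only [fixedCost, not_le.2 one_pos, if_false] at hopt
      simp only [RGRT, intervalIntegral.integral_same, hC.2.2.2]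
      nlinarith [mul_nonneg (sub_nonneg.2 hα1) hM0]
  rw [not_lt] at hlow
  by_cases hqq : q₁ ≤ q
  · have hC' := isCost_fixedCost le_rfl
    have hzero : ∀ z, fixedCost 0 z = 0 := fun z => by simp [fixedCost]
    refine le_WCR hV hC' (q := q₁) (p := p₁) ⟨hf₁, fun q' p' h => ?_⟩
      ((min_le_left _ _).trans ?_)
    · simpa [hzero] using hle₁ q' p' h
    · have hopt := le_OPT hV hC' (q := 1) (by simp)
      have h1 := integral_le_mul_of_demand_le (V := hyperbolicDemand vbar q p) hf₁.1.1
        (fun z hz => hV.2.2 z ⟨hz.1.le, hz.2.trans hf₁.1.2⟩)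
      rw [hintegral] at hopt
      simp only [RGRT, hzero] at hopt ⊢
      nlinarith [mul_nonneg (sub_nonneg.2 hα1) (show 0 ≤ ρ q₁ p₁ - q * kcap vbar α by linarith),
        mul_le_mul_of_nonneg_left hqq hv.le]
  · rw [not_le] at hqq
    have hq₁ : 0 < q₁ := hq.1.trans_lt hqq
    have hrev : q₁ * p₁ ≤ q * p := by
      have h := hf₁.2.2
      simp only [hyperbolicDemand, stepDemand, not_le.2 hqq, if_false] at h
      rwa [le_div_iff₀ hq₁, mul_comm] at h
    have hV' : IsDemand vbar (stepDemand q₁ p₁ fun _ => 0) :=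
      isDemand_stepDemand hf₁.2.1 antitoneOn_const continuousOn_const
        fun z _ => ⟨le_rfl, hf₁.2.1.1⟩
    have hcost : fixedCost (ρ q₁ p₁ - ρ 0 p₀) q₁ = ρ q₁ p₁ - ρ 0 p₀ := by
      simp [fixedCost, not_le.2 hq₁]
    refine le_WCR hV' hC (q := q₁) (p := p₁) ⟨⟨hf₁.1, hf₁.2.1, by simp [stepDemand]⟩,
      fun q' p' h => ?_⟩ ((min_le_right _ _).trans ?_)
    · rw [hcost]
      refine (hprofit q' p' ⟨h.1, h.2.1, h.2.2.trans ?_⟩).trans (by linarith)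
      by_cases h' : q' ≤ q₁
      · simpa [stepDemand, h'] using hf₁.2.2.trans (hV.1 h.1 hf₁.1 h')
      · simpa [stepDemand, h'] using (hV.2.2 q' h.1).1
    · have hopt := le_OPT hV' hC (q := 0) (by simp)
      have h1 := integral_le_mul_of_demand_le (V := stepDemand q₁ p₁ fun _ => 0) (a := p₁) hq₁.le
        (fun z hz => by simp [stepDemand, hz.2, hf₁.2.1.1])
      rw [intervalIntegral.integral_same, hC.2.2.2] at hopt
      simp only [RGRT, hcost]
      nlinarith [mul_nonneg (sub_nonneg.2 hα1) hM0]

/-- **Theorem 1, lower bound.** For every policy `rho`, the worst-case regret is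
at least `r_alpha`. -/
theorem worst_case_regret_lower_bound
    (vbar alpha : ℝ) (hv : 0 < vbar) (halpha : alpha ∈ Icc (0:ℝ) 1)
    (ρ : ℝ → ℝ → ℝ) (hρ : IsPolicy vbar ρ) :
    ((rbound vbar alpha : ℝ) : EReal) ≤ WCR vbar alpha ρ := by
  by_contra! h
  obtain ⟨m, h1, h2⟩ := EReal.lt_iff_exists_real_btwn.1 h
  obtain ⟨_, ⟨q, hq, p, hp, rfl⟩, hm⟩ := exists_lt_of_lt_csSup
    (by exact ⟨_, 0, by simp, 0, ⟨le_rfl, div_nonneg hv.le (by linarith [halpha.2])⟩, rfl⟩)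
    (EReal.coe_lt_coe_iff.1 h2)
  exact absurd (regretFn_le_WCR hv halpha hρ hq hp)
    (not_le.2 (h1.trans (EReal.coe_lt_coe_iff.2 hm)))
end
end

section
/- If α ≤ 1/2, then r_α = sup_{q∈[0,1], p∈[0,k_α]} min( (1−α)·q·k_α − q·p·log q , q·(k_α − p) ) equals v̄·(1−α)/(2−α), and this supremum is attained at q = 1 (for instance with p = 0). -/
open Real Set MeasureTheory

noncomputable section

/-- A weighted-average inequality, following from `-log q ≤ q⁻¹ - 1`. -/
lemma mul_sub_log_le {q b : ℝ} (hq : 0 < q) (hq1 : q ≤ 1) (hb : 1 / 2 ≤ b) :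
    q * (b - Real.log q) ≤ b * (1 - Real.log q) := by
  have hlog : Real.log q ≤ 0 := Real.log_nonpos hq.le hq1
  have hlow : q - 1 ≤ q * Real.log q := by
    have h := mul_le_mul_of_nonneg_left (Real.one_sub_inv_le_log_of_pos hq) hq.le
    rwa [mul_sub, mul_one, mul_inv_cancel₀ hq.ne'] at h
  nlinarith [mul_nonneg (sub_nonneg.2 hb) (by linarith : 0 ≤ 1 - Real.log q - q),
    mul_nonneg (sub_nonneg.2 hq1) (neg_nonneg.2 hlog)]

lemma kcap_nonneg {vbar alpha : ℝ} (hv : 0 ≤ vbar) (halpha : alpha ≤ 2) :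
    0 ≤ kcap vbar alpha :=
  div_nonneg hv (sub_nonneg.2 halpha)

lemma regretFn_le {vbar alpha q p : ℝ} (hv : 0 ≤ vbar) (halpha : alpha ≤ 1 / 2)
    (hq : q ∈ Icc (0:ℝ) 1) :
    regretFn vbar alpha q p ≤ (1 - alpha) * kcap vbar alpha := by
  have hk : 0 ≤ kcap vbar alpha := kcap_nonneg hv (by linarith)
  unfold regretFn
  generalize kcap vbar alpha = k at hk ⊢
  rcases hq.1.eq_or_lt with rfl | hq0
  · simpa using mul_nonneg (by linarith : 0 ≤ 1 - alpha) hk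
  · by_contra! h
    obtain ⟨hA, hB⟩ := lt_min_iff.1 h
    have hlog : 0 ≤ -Real.log q := neg_nonneg.2 (Real.log_nonpos hq0.le hq.2)
    have havg := mul_le_mul_of_nonneg_left
      (mul_sub_log_le hq0 hq.2 (by linarith : 1 / 2 ≤ 1 - alpha)) hk
    have hB' := mul_le_mul_of_nonneg_left hB.le hlog
    linarith

lemma regretFn_one_zero {vbar alpha : ℝ} (hv : 0 ≤ vbar) (halpha : alpha ∈ Icc (0:ℝ) 2) :
    regretFn vbar alpha 1 0 = (1 - alpha) * kcap vbar alpha := by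
  have h := mul_nonneg halpha.1 (kcap_nonneg hv halpha.2)
  have hle : (1 - alpha) * kcap vbar alpha ≤ kcap vbar alpha := by linarith
  simpa [regretFn] using hle

/-- For `alpha ≤ 1/2`, `r_alpha = vbar * (1 - alpha) / (2 - alpha)`, and the
supremum defining `r_alpha` is attained at `q = 1`, for instance with `p = 0`. -/
theorem rbound_eq_of_le_half
    (vbar alpha : ℝ) (hv : 0 < vbar) (halpha : alpha ∈ Icc (0:ℝ) 1) (hhalf : alpha ≤ 1/2) :
    rbound vbar alpha = vbar * (1 - alpha) / (2 - alpha) ∧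
      regretFn vbar alpha 1 0 = rbound vbar alpha := by
  have h2 : alpha ∈ Icc (0:ℝ) 2 := ⟨halpha.1, by linarith⟩
  have hattain := regretFn_one_zero hv.le h2
  have hgreatest : IsGreatest
      { x | ∃ q ∈ Icc (0:ℝ) 1, ∃ p ∈ Icc (0:ℝ) (kcap vbar alpha), x = regretFn vbar alpha q p }
      ((1 - alpha) * kcap vbar alpha) := by
    refine ⟨⟨1, by simp, 0, ⟨le_rfl, kcap_nonneg hv.le h2.2⟩, hattain.symm⟩, ?_⟩
    rintro x ⟨q, hq, p, -, rfl⟩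
    exact regretFn_le hv.le hhalf hq
  have hr : rbound vbar alpha = (1 - alpha) * kcap vbar alpha := hgreatest.csSup_eq
  refine ⟨?_, hattain.trans hr.symm⟩
  rw [hr, kcap]
  ring
end
end

section
/- If α > 1/2, then r_α = sup_{q∈[0,1], p∈[0,k_α]} min( (1−α)·q·k_α − q·p·log q , q·(k_α − p) ) equals v̄·(2+α−√(α(α+4)))·e^{1−(α+√(α(α+4)))/2} / (2(2−α)), and this supremum is attained at the quantity q_α = e^{1−(α+√(α(α+4)))/2} together with some price p ∈ [0,k_α]. -/
open Real Set MeasureTheory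

noncomputable section

/-- A root `u < 1 + α` of `u ^ 2 = α * (u + 1)` maximizes `w ↦ exp (1 - w) * (1 - α / w)`
over the positive reals. -/
lemma sub_mul_exp_le_of_sq_eq {α u w : ℝ} (hu : u ^ 2 = α * (u + 1))
    (huα : u < 1 + α) (hw : 0 < w) :
    (w - α) * Real.exp (1 - w) ≤ w * ((1 + α - u) * Real.exp (1 - u)) := by
  have hexp : Real.exp (1 - u) = Real.exp (1 - w) * Real.exp (w - u) := by
    rw [← Real.exp_add]; ring_nf
  have hc : 0 < 1 + α - u := by linarith
  have hlow : 1 + (w - u) ≤ Real.exp (w - u) := by linarith [Real.add_one_le_exp (w - u)]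
  have hsq : w - α ≤ w * (1 + α - u) * (1 + (w - u)) := by
    have hid : w * (1 + α - u) * (1 + (w - u)) - (w - α) = (1 + α - u) * (w - u) ^ 2 := by
      linear_combination (u - w - 1) * hu
    nlinarith [mul_nonneg hc.le (sq_nonneg (w - u))]
  have hmain : w - α ≤ w * (1 + α - u) * Real.exp (w - u) :=
    hsq.trans (mul_le_mul_of_nonneg_left hlow (mul_pos hw hc).le)
  calc (w - α) * Real.exp (1 - w)
      ≤ w * (1 + α - u) * Real.exp (w - u) * Real.exp (1 - w) :=
        mul_le_mul_of_nonneg_right hmain (Real.exp_pos _).le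
    _ = w * ((1 + α - u) * Real.exp (1 - u)) := by rw [hexp]; ring

/-- The minimum is at most the average with weights `1` and `-log q`, which is free of `p`. -/
lemma one_sub_log_mul_regretFn_le (vbar α p : ℝ) {q : ℝ} (hq0 : 0 ≤ q) (hq1 : q ≤ 1) :
    (1 - Real.log q) * regretFn vbar α q p ≤ kcap vbar α * ((1 - Real.log q - α) * q) := by
  have hlog : Real.log q ≤ 0 := Real.log_nonpos hq0 hq1
  have h1 : regretFn vbar α q p ≤ (1 - α) * q * kcap vbar α - q * p * Real.log q := min_le_left _ _
  have h2 : regretFn vbar α q p ≤ q * (kcap vbar α - p) := min_le_right _ _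
  nlinarith [mul_le_mul_of_nonneg_left h2 (neg_nonneg.2 hlog)]

lemma regretFn_le_of_sq_eq {vbar α u q : ℝ} (p : ℝ) (hk : 0 ≤ kcap vbar α)
    (hu : u ^ 2 = α * (u + 1)) (huα : u < 1 + α) (hq : q ∈ Icc (0:ℝ) 1) :
    regretFn vbar α q p ≤ kcap vbar α * ((1 + α - u) * Real.exp (1 - u)) := by
  rcases hq.1.eq_or_lt with rfl | hq0
  · have hc : 0 ≤ 1 + α - u := by linarith
    have : 0 ≤ kcap vbar α * ((1 + α - u) * Real.exp (1 - u)) := by positivity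
    simpa [regretFn] using this
  · have hw : 0 < 1 - Real.log q := by linarith [Real.log_nonpos hq.1 hq.2]
    have hmax := sub_mul_exp_le_of_sq_eq hu huα hw
    rw [sub_sub_cancel, Real.exp_log hq0] at hmax
    refine le_of_mul_le_mul_left ?_ hw
    calc (1 - Real.log q) * regretFn vbar α q p
        ≤ kcap vbar α * ((1 - Real.log q - α) * q) :=
          one_sub_log_mul_regretFn_le vbar α p hq.1 hq.2
      _ ≤ kcap vbar α * ((1 - Real.log q) * ((1 + α - u) * Real.exp (1 - u))) :=
          mul_le_mul_of_nonneg_left hmax hk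
      _ = (1 - Real.log q) * (kcap vbar α * ((1 + α - u) * Real.exp (1 - u))) := by ring

/-- At the price `(u - α) * k_α` both terms of the minimum agree. -/
lemma regretFn_exp_eq_of_sq_eq {vbar α u : ℝ} (hu : u ^ 2 = α * (u + 1)) :
    regretFn vbar α (Real.exp (1 - u)) ((u - α) * kcap vbar α) =
      kcap vbar α * ((1 + α - u) * Real.exp (1 - u)) := by
  have h : (1 - α) * Real.exp (1 - u) * kcap vbar α -
      Real.exp (1 - u) * ((u - α) * kcap vbar α) * (1 - u) =
      Real.exp (1 - u) * (kcap vbar α - (u - α) * kcap vbar α) := by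
    linear_combination Real.exp (1 - u) * kcap vbar α * hu
  rw [regretFn, Real.log_exp, h, min_self]
  ring

/-- For `alpha > 1/2`, `r_alpha` has the stated closed form, and the supremum
defining `r_alpha` is attained at the quantity `q_alpha = exp (1 - (alpha + sqrt (alpha * (alpha + 4))) / 2)`
together with some price `p ∈ [0, k_alpha]`. -/
theorem rbound_eq_of_gt_half
    (vbar alpha : ℝ) (hv : 0 < vbar) (halpha : alpha ∈ Icc (0:ℝ) 1) (hhalf : 1/2 < alpha) :
    rbound vbar alpha =
        vbar * (2 + alpha - Real.sqrt (alpha * (alpha + 4))) *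
          Real.exp (1 - (alpha + Real.sqrt (alpha * (alpha + 4))) / 2) / (2 * (2 - alpha)) ∧
      ∃ p ∈ Icc (0:ℝ) (kcap vbar alpha),
        regretFn vbar alpha (Real.exp (1 - (alpha + Real.sqrt (alpha * (alpha + 4))) / 2)) p =
          rbound vbar alpha := by
  have hα1 : alpha ≤ 1 := halpha.2
  have hsq : Real.sqrt (alpha * (alpha + 4)) ^ 2 = alpha * (alpha + 4) :=
    Real.sq_sqrt (by nlinarith)
  have hs0 : 0 ≤ Real.sqrt (alpha * (alpha + 4)) := Real.sqrt_nonneg _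
  have hs_lower : 2 - alpha ≤ Real.sqrt (alpha * (alpha + 4)) :=
    Real.le_sqrt_of_sq_le (by nlinarith)
  have hs_upper : Real.sqrt (alpha * (alpha + 4)) < 2 + alpha := by nlinarith
  have hk : 0 < kcap vbar alpha := div_pos hv (by linarith)
  set s := Real.sqrt (alpha * (alpha + 4)) with hs
  obtain ⟨u, hu_def⟩ : ∃ u, u = (alpha + s) / 2 := ⟨_, rfl⟩
  have hu : u ^ 2 = alpha * (u + 1) := by
    rw [hu_def]; linear_combination hsq / 4
  have hu1 : 1 ≤ u := by linarith
  have huα : u < 1 + alpha := by linarith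
  have hvalue : vbar * (2 + alpha - s) * Real.exp (1 - u) / (2 * (2 - alpha)) =
      kcap vbar alpha * ((1 + alpha - u) * Real.exp (1 - u)) := by
    have h2 : 2 - alpha ≠ 0 := by linarith
    have hsu : s = 2 * u - alpha := by linarith
    rw [kcap, hsu]
    field_simp
    ring
  have hp : (u - alpha) * kcap vbar alpha ∈ Icc (0:ℝ) (kcap vbar alpha) :=
    ⟨mul_nonneg (by linarith) hk.le, mul_le_of_le_one_left hk.le (by linarith)⟩
  have hr : rbound vbar alpha = kcap vbar alpha * ((1 + alpha - u) * Real.exp (1 - u)) := by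
    refine IsGreatest.csSup_eq ⟨⟨Real.exp (1 - u), ⟨(Real.exp_pos _).le,
      Real.exp_le_one_iff.2 (by linarith)⟩, _, hp, (regretFn_exp_eq_of_sq_eq hu).symm⟩, ?_⟩
    rintro x ⟨q, hq, p, -, rfl⟩
    exact regretFn_le_of_sq_eq p hk.le hu huα hq
  rw [← hu_def]
  exact ⟨hr.trans hvalue.symm, _, hp, (regretFn_exp_eq_of_sq_eq hu).trans hr.symm⟩
end
end

section
/- Consider an unregulated firm, i.e., the policy ρ(q,p) = q·p. For every inverse-demand function V, every cost function C, and every firm's best response (q,p) to (V,C) under ρ, the firm's profit satisfies FP = q·p − C(q) ≥ OPT(V,C) − v̄/e. -/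
open Real Set MeasureTheory

noncomputable section

/-- If `V ≤ v` and `z * V z ≤ A` on `[0, Q]`, splitting the integral at `Q / e` bounds it
by `v * Q / e + A`. -/
theorem AntitoneOn.integral_le_div_exp_one_add {V : ℝ → ℝ} {v A Q : ℝ} (hQ : 0 < Q)
    (hV : AntitoneOn V (Icc 0 Q)) (hv : ∀ z ∈ Icc 0 Q, V z ≤ v)
    (hA : ∀ z ∈ Icc 0 Q, z * V z ≤ A) :
    ∫ z in (0:ℝ)..Q, V z ≤ v * (Q / exp 1) + A := by
  have ht : 0 < Q / exp 1 := by positivity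
  have htQ : Q / exp 1 ≤ Q := div_le_self hQ.le (one_le_exp zero_le_one)
  have hint {a b : ℝ} (ha : 0 ≤ a) (hab : a ≤ b) (hb : b ≤ Q) :
      IntervalIntegrable V volume a b :=
    AntitoneOn.intervalIntegrable (hV.mono (uIcc_of_le hab ▸ Icc_subset_Icc ha hb))
  have hlow : ∫ z in (0:ℝ)..(Q / exp 1), V z ≤ v * (Q / exp 1) := by
    have h := intervalIntegral.integral_mono_on ht.le (hint le_rfl ht.le htQ)
      (intervalIntegrable_const (c := v)) fun z hz => hv z ⟨hz.1, hz.2.trans htQ⟩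
    simpa [mul_comm] using h
  have hinv : IntervalIntegrable (fun z : ℝ => z⁻¹) volume (Q / exp 1) Q := by
    refine intervalIntegral.intervalIntegrable_inv (fun z hz => ?_) continuousOn_id
    rw [uIcc_of_le htQ] at hz
    exact (ht.trans_le hz.1).ne'
  have hhigh : ∫ z in (Q / exp 1)..Q, V z ≤ A := by
    have h := intervalIntegral.integral_mono_on htQ (hint ht.le htQ le_rfl)
      (hinv.const_mul A) fun z hz => by
        have hz0 : 0 < z := ht.trans_le hz.1
        rw [← div_eq_mul_inv, le_div_iff₀ hz0, mul_comm]
        exact hA z ⟨hz0.le, hz.2⟩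
    rwa [intervalIntegral.integral_const_mul, integral_inv_of_pos ht hQ,
      div_div_cancel₀ hQ.ne', log_exp, mul_one] at h
  rw [← intervalIntegral.integral_add_adjacent_intervals (hint le_rfl ht.le htQ)
    (hint ht.le htQ le_rfl)]
  exact add_le_add hlow hhigh

/-- **Corollary 1.** An unregulated firm (policy `ρ (q, p) = q * p`) which best
responds to `(V, C)` earns profit `FP = q * p - C q ≥ OPT (V, C) - vbar / e`. -/
theorem unregulated_profit_ge_OPT_sub
    (vbar : ℝ) (hv : 0 < vbar)
    (V C : ℝ → ℝ) (hV : IsDemand vbar V) (hC : IsCost C)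
    (q p : ℝ) (hbr : BestResponse vbar V C (fun q p => q * p) q p) :
    OPT V C - vbar / Real.exp 1 ≤ q * p - C q := by
  obtain ⟨hanti, -, hrange⟩ := hV
  obtain ⟨hmono, -, -, hC0⟩ := hC
  have hprofit (z : ℝ) (hz : z ∈ Icc (0:ℝ) 1) : z * V z - C z ≤ q * p - C q :=
    hbr.2 z (V z) ⟨hz, hrange z hz, le_rfl⟩
  rw [sub_le_iff_le_add]
  refine csSup_le ⟨_, 0, ⟨le_rfl, zero_le_one⟩, rfl⟩ ?_
  rintro x ⟨Q, hQ, rfl⟩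
  rcases hQ.1.eq_or_lt with rfl | hQ0
  · have h := hprofit 0 hQ
    have : 0 < vbar / exp 1 := by positivity
    simp only [intervalIntegral.integral_same, hC0, zero_mul] at h ⊢
    linarith
  · have hsub : Icc 0 Q ⊆ Icc (0:ℝ) 1 := Icc_subset_Icc_right hQ.2
    have h := AntitoneOn.integral_le_div_exp_one_add (A := q * p - C q + C Q) hQ0
      (hanti.mono hsub) (fun z hz => (hrange z (hsub hz)).2) fun z hz => by
        linarith [hprofit z (hsub hz), hmono (hsub hz) hQ hz.2]
    have hle : vbar * (Q / exp 1) ≤ vbar / exp 1 := by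
      rw [← mul_div_assoc]
      gcongr
      exact mul_le_of_le_one_right hv.le hQ.2
    linarith
end
end

section
/- (Regret from overproduction.) Let k ∈ (0,v̄], s ≥ 0, and consider the policy ρ(q,p) = min( q·k , q·p + s ). Let V be an inverse-demand function, C a cost function, and let q* ∈ [0,1] attain the social optimum OPT(V,C), with p* = V(q*). If (q,p) is a firm's best response to (V,C) under ρ with q ≥ q* and p ≤ V(q), then the regret satisfies RGRT ≤ max( (1−α)·k , s ). -/
open Real Set MeasureTheory

noncomputable section

/-- The estimate behind the regret bound: `r` is the reward at `(q, p)`, and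
`min (x * k) (x * P + s)` the reward at a smaller quantity `x` and higher price `P`. -/
lemma overproduction_bound {alpha k s x q p P r : ℝ} (ha1 : alpha ≤ 1)
    (hk : 0 ≤ k) (hx0 : 0 ≤ x) (hxq : x ≤ q) (hq1 : q ≤ 1)
    (hpP : p ≤ P) (hr1 : r ≤ q * k) (hr2 : r ≤ q * p + s) :
    r - alpha * min (x * k) (x * P + s) - (q - x) * p ≤ max ((1 - alpha) * k) s := by
  have hak : 0 ≤ (1 - alpha) * k := mul_nonneg (by linarith) hk
  rcases le_total (x * k) (x * P + s) with h | h
  · rw [min_eq_left h]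
    rcases le_total p (alpha * k) with hp | hp
    · refine le_max_of_le_right ?_
      nlinarith [mul_nonneg hx0 (sub_nonneg.2 hp)]
    · refine le_max_of_le_left ?_
      nlinarith [mul_nonneg (sub_nonneg.2 hxq) (sub_nonneg.2 hp),
        mul_nonneg (sub_nonneg.2 hq1) hak]
  · rw [min_eq_right h]
    refine le_max_of_le_left ?_
    nlinarith [mul_nonneg hx0 (sub_nonneg.2 hpP), mul_nonneg (sub_nonneg.2 ha1) (sub_nonneg.2 h),
      mul_nonneg (sub_nonneg.2 (hxq.trans hq1)) hak]

/-- An antitone function has integral over `[x, q]` at least `(q - x)` times its value at `q`. -/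
lemma AntitoneOn.mul_le_integral_sub {V : ℝ → ℝ} (hV : AntitoneOn V (Icc 0 1)) {x q : ℝ}
    (hx : x ∈ Icc (0:ℝ) 1) (hq : q ∈ Icc (0:ℝ) 1) (hxq : x ≤ q) :
    (q - x) * V q ≤ (∫ z in (0:ℝ)..q, V z) - ∫ z in (0:ℝ)..x, V z := by
  have hint : ∀ a ∈ Icc (0:ℝ) 1, ∀ b ∈ Icc (0:ℝ) 1, IntervalIntegrable V volume a b :=
    fun a ha b hb => (hV.mono (uIcc_subset_Icc ha hb)).intervalIntegrable
  have h0 : (0:ℝ) ∈ Icc (0:ℝ) 1 := by simp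
  rw [intervalIntegral.integral_interval_sub_left (hint 0 h0 q hq) (hint 0 h0 x hx)]
  have h := intervalIntegral.integral_mono_on hxq (intervalIntegrable_const (c := V q))
    (hint x hx q hq) fun z hz => hV ⟨hx.1.trans hz.1, hz.2.trans hq.2⟩ hq hz.2
  simpa using h

/-- **Claim 5, regret from overproduction.** Under the policy
`ρ (q, p) = min (q * k) (q * p + s)`, if `qstar` attains the social optimum, `pstar = V qstar`,
and the firm best responds with `(q, p)` where `q ≥ qstar` and `p ≤ V q`, then the regret is
at most `max ((1 - alpha) * k) s`. -/
theorem regret_from_overproduction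
    (vbar alpha k s : ℝ) (hv : 0 < vbar) (halpha : alpha ∈ Icc (0:ℝ) 1)
    (hk : k ∈ Ioc (0:ℝ) vbar) (hs : 0 ≤ s)
    (V C : ℝ → ℝ) (hV : IsDemand vbar V) (hC : IsCost C)
    (qstar pstar : ℝ) (hqstar : qstar ∈ Icc (0:ℝ) 1)
    (hoptattain : (∫ z in (0:ℝ)..qstar, V z) - C qstar = OPT V C)
    (hpstar : pstar = V qstar)
    (q p : ℝ)
    (hbr : BestResponse vbar V C (fun q p => min (q * k) (q * p + s)) q p)
    (hover : qstar ≤ q) (hfeas : p ≤ V q) :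
    RGRT vbar alpha V C (fun q p => min (q * k) (q * p + s)) q p ≤
      max ((1 - alpha) * k) s := by
  obtain ⟨⟨hq, -, -⟩, hbest⟩ := hbr
  have hI := hV.1.mul_le_integral_sub hqstar hq hover
  have hVle : V q ≤ V qstar := hV.1 hqstar hq hover
  have hB := hbest qstar (V qstar) ⟨hqstar, hV.2.2 _ hqstar, le_rfl⟩
  have hCx := hC.2.2.1 _ hqstar
  have hkey := overproduction_bound (s := s) halpha.2 hk.1.le hqstar.1 hover hq.2
    (hfeas.trans hVle) (min_le_left (q * k) (q * p + s)) (min_le_right _ _)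
  refine le_trans ?_ hkey
  unfold RGRT
  rw [← hoptattain]
  dsimp only at hB ⊢
  nlinarith [mul_le_mul_of_nonneg_left hB halpha.1, mul_nonneg (sub_nonneg.2 halpha.2) hCx,
    mul_nonneg (sub_nonneg.2 hover) (sub_nonneg.2 hfeas)]
end
end

section
/- (Regret from underproduction.) Let k ∈ (0,v̄], s ≥ 0, and consider the policy ρ(q,p) = min( q·k , q·p + s ). Let V be an inverse-demand function, C a cost function, and let q* ∈ [0,1] attain the social optimum OPT(V,C). If (q,p) is a firm's best response to (V,C) under ρ with q ≤ q*, then the regret satisfies RGRT ≤ sup_{q'∈(0,1]} ( q'·max( (1−α)·k , v̄ − k ) − (q'·k − s)·log q' ). -/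
open Real Set MeasureTheory

noncomputable section

lemma bddAbove_underproduction_regret {M k s : ℝ} (hM : 0 ≤ M) (hk : 0 ≤ k) (hs : 0 ≤ s) :
    BddAbove { x | ∃ q' ∈ Ioc (0:ℝ) 1, x = q' * M - (q' * k - s) * Real.log q' } := by
  refine ⟨M + k, ?_⟩
  rintro x ⟨t, ⟨h0, h1⟩, rfl⟩
  have hlog : Real.log t ≤ 0 := Real.log_nonpos h0.le h1
  have hinv : t - 1 ≤ t * Real.log t := by
    have h := mul_le_mul_of_nonneg_left (Real.one_sub_inv_le_log_of_pos h0) h0.le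
    rwa [mul_sub, mul_one, mul_inv_cancel₀ h0.ne'] at h
  nlinarith [mul_le_mul_of_nonneg_right h1 hM, mul_le_mul_of_nonneg_left hinv hk,
    mul_nonneg hs (neg_nonneg.2 hlog), mul_nonneg hk h0.le]

lemma integral_le_neg_mul_log {V : ℝ → ℝ} {a b B : ℝ} (ha : 0 < a) (hab : a ≤ b) (hb : b ≤ 1)
    (hB : 0 ≤ B) (hV : IntervalIntegrable V volume a b)
    (h : ∀ z ∈ Ioo a b, z * V z ≤ B) :
    ∫ z in a..b, V z ≤ -(B * Real.log a) := by
  have hb0 : 0 < b := ha.trans_le hab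
  have h0 : (0:ℝ) ∉ uIcc a b := by
    rw [uIcc_of_le hab]
    exact fun h0 => ha.not_ge h0.1
  have hint : IntervalIntegrable (fun z : ℝ => B * z⁻¹) volume a b :=
    (intervalIntegral.intervalIntegrable_inv (fun x hx hx0 => h0 (hx0 ▸ hx))
      continuousOn_id).const_mul B
  calc ∫ z in a..b, V z ≤ ∫ z in a..b, B * z⁻¹ := by
        refine intervalIntegral.integral_mono_on_of_le_Ioo hab hV hint fun z hz => ?_
        rw [← div_eq_mul_inv, le_div_iff₀ (ha.trans hz.1), mul_comm]
        exact h z hz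
    _ = B * (Real.log b - Real.log a) := by
        rw [intervalIntegral.integral_const_mul, integral_inv h0,
          Real.log_div hb0.ne' ha.ne']
    _ ≤ -(B * Real.log a) := by
        nlinarith [mul_nonneg hB (neg_nonneg.2 (Real.log_nonpos hb0.le hb))]

lemma integral_le_sub_mul {V : ℝ → ℝ} {a b c : ℝ} (hab : a ≤ b)
    (hV : IntervalIntegrable V volume a b) (h : ∀ z ∈ Ioo a b, V z ≤ c) :
    ∫ z in a..b, V z ≤ (b - a) * c := by
  simpa using intervalIntegral.integral_mono_on_of_le_Ioo hab hV
    (intervalIntegrable_const (c := c)) h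

/-- **Claim 6, regret from underproduction.** Under the policy
`ρ (q, p) = min (q * k) (q * p + s)`, if `qstar` attains the social optimum and the firm best
responds with `(q, p)` where `q ≤ qstar`, then the regret is at most
`sup_{q' ∈ (0,1]} (q' * max ((1 - alpha) * k) (vbar - k) - (q' * k - s) * log q')`. -/
theorem regret_from_underproduction
    (vbar alpha k s : ℝ) (hv : 0 < vbar) (halpha : alpha ∈ Icc (0:ℝ) 1)
    (hk : k ∈ Ioc (0:ℝ) vbar) (hs : 0 ≤ s)
    (V C : ℝ → ℝ) (hV : IsDemand vbar V) (hC : IsCost C)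
    (qstar : ℝ) (hqstar : qstar ∈ Icc (0:ℝ) 1)
    (hoptattain : (∫ z in (0:ℝ)..qstar, V z) - C qstar = OPT V C)
    (q p : ℝ)
    (hbr : BestResponse vbar V C (fun q p => min (q * k) (q * p + s)) q p)
    (hunder : q ≤ qstar) :
    RGRT vbar alpha V C (fun q p => min (q * k) (q * p + s)) q p ≤
      sSup { x | ∃ q' ∈ Ioc (0:ℝ) 1,
        x = q' * max ((1 - alpha) * k) (vbar - k) - (q' * k - s) * Real.log q' } := by
  obtain ⟨hk0, hkv⟩ := hk
  obtain ⟨ha0, ha1⟩ := halpha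
  obtain ⟨hVanti, -, hVrange⟩ := hV
  obtain ⟨hCmono, -, hCnonneg, hC0⟩ := hC
  obtain ⟨⟨⟨hq0, hq1⟩, hp, hpV⟩, hbest⟩ := hbr
  obtain ⟨hqs0, hqs1⟩ := hqstar
  set M := max ((1 - alpha) * k) (vbar - k)
  have hM1 : (1 - alpha) * k ≤ M := le_max_left _ _
  have hM2 : vbar - k ≤ M := le_max_right _ _
  have hM0 : 0 ≤ M := (mul_nonneg (by linarith) hk0.le).trans hM1
  have le_value : ∀ t, 0 < t → t ≤ 1 → t * M - (t * k - s) * Real.log t ≤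
      sSup { x | ∃ q' ∈ Ioc (0:ℝ) 1, x = q' * M - (q' * k - s) * Real.log q' } :=
    fun t h0 h1 => le_csSup (bddAbove_underproduction_regret hM0 hk0.le hs) ⟨t, ⟨h0, h1⟩, rfl⟩
  have hMle := le_value 1 one_pos le_rfl
  simp only [Real.log_one, mul_zero, sub_zero, one_mul] at hMle
  have hVint : ∀ a b, 0 ≤ a → a ≤ b → b ≤ 1 → IntervalIntegrable V volume a b := by
    intro a b h0 hab h1
    refine AntitoneOn.intervalIntegrable ?_
    rw [uIcc_of_le hab]
    exact hVanti.mono (Icc_subset_Icc h0 h1)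
  have hsplit : (∫ z in (0:ℝ)..qstar, V z) - ∫ z in (0:ℝ)..q, V z = ∫ z in q..qstar, V z :=
    intervalIntegral.integral_interval_sub_left (hVint 0 qstar le_rfl hqs0 hqs1)
      (hVint 0 q le_rfl hq0 hq1)
  have hRGRT : RGRT vbar alpha V C (fun q p => min (q * k) (q * p + s)) q p =
      (∫ z in q..qstar, V z) - (C qstar - C q) +
        (1 - alpha) * (min (q * k) (q * p + s) - C q) := by
    rw [RGRT, ← hoptattain, ← hsplit]
    ring
  rw [hRGRT]
  have hrev : min (q * k) (q * p + s) ≤ q * k := min_le_left _ _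
  have hrev0 : 0 ≤ min (q * k) (q * p + s) :=
    le_min (mul_nonneg hq0 hk0.le) (add_nonneg (mul_nonneg hq0 hp.1) hs)
  simp only at hbest
  set R := min (q * k) (q * p + s)
  have hCq : 0 ≤ C q := hCnonneg q ⟨hq0, hq1⟩
  have hD : C q ≤ C qstar := hCmono ⟨hq0, hq1⟩ ⟨hqs0, hqs1⟩ hunder
  have hprofit : (1 - alpha) * (R - C q) ≤ (1 - alpha) * (q * k) :=
    mul_le_mul_of_nonneg_left (by linarith) (by linarith)
  have hprofitR : (1 - alpha) * (R - C q) ≤ (1 - alpha) * R :=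
    mul_le_mul_of_nonneg_left (by linarith) (by linarith)
  obtain ⟨A, hA⟩ : ∃ A, A = R + C qstar - C q := ⟨_, rfl⟩
  have hRA : R ≤ A := by linarith
  have hrevenue : ∀ z, 0 ≤ z → z ≤ qstar → A < z * k → z * V z ≤ A - s := by
    intro z h0 h1 hz
    have hz1 : z ∈ Icc (0:ℝ) 1 := ⟨h0, h1.trans hqs1⟩
    have hb := hbest z (V z) ⟨hz1, hVrange z hz1, le_rfl⟩
    have hCz : C z ≤ C qstar := hCmono hz1 ⟨hqs0, hqs1⟩ h1
    rcases min_le_iff.1 (show min (z * k) (z * V z + s) ≤ A by linarith) with h | h <;> linarith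
  have hVle : ∀ z, 0 ≤ z → z ≤ 1 → V z ≤ vbar := fun z h0 h1 => (hVrange z ⟨h0, h1⟩).2
  have hsurplus : ∀ t, q ≤ t → (t - q) * (vbar - k) + (1 - alpha) * (q * k) ≤ t * M := by
    intro t ht
    nlinarith [mul_le_mul_of_nonneg_left hM2 (sub_nonneg.2 ht), mul_le_mul_of_nonneg_left hM1 hq0]
  rcases le_or_gt (qstar * k) A with hAq | hAq
  · have hint := integral_le_sub_mul hunder (hVint q qstar hq0 hunder hqs1)
      fun z hz => hVle z (hq0.trans hz.1.le) (hz.2.le.trans hqs1)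
    nlinarith [hsurplus qstar hunder, mul_le_mul_of_nonneg_right hqs1 hM0]
  have hB : 0 ≤ A - s :=
    (mul_nonneg hqs0 (hVrange qstar ⟨hqs0, hqs1⟩).1).trans (hrevenue qstar hqs0 le_rfl hAq)
  rcases le_or_gt (q * k) A with hAk | hAk
  · obtain ⟨t, rfl⟩ : ∃ t, A = t * k := ⟨A / k, by field_simp⟩
    have hqt : q ≤ t := le_of_mul_le_mul_right hAk hk0
    have hts : t < qstar := lt_of_mul_lt_mul_right hAq hk0.le
    rcases (hq0.trans hqt).eq_or_lt with ht0 | ht0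
    · subst ht0
      obtain rfl : q = 0 := le_antisymm hqt hq0
      have hint := integral_le_sub_mul (c := 0) hunder (hVint 0 qstar hq0 hunder hqs1)
        fun z hz => by
          have h := hrevenue z hz.1.le hz.2.le (by simpa using mul_pos hz.1 hk0)
          by_contra! hVz
          nlinarith [mul_pos hz.1 hVz]
      linarith
    · have hint1 := integral_le_sub_mul hqt (hVint q t hq0 hqt (hts.le.trans hqs1))
        fun z hz => hVle z (hq0.trans hz.1.le) (hz.2.le.trans (hts.le.trans hqs1))
      have hint2 := integral_le_neg_mul_log ht0 hts.le hqs1 hB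
        (hVint t qstar ht0.le hts.le hqs1)
        fun z hz => hrevenue z (ht0.trans hz.1).le hz.2.le (mul_lt_mul_of_pos_right hz.1 hk0)
      have hadd := intervalIntegral.integral_add_adjacent_intervals
        (hVint q t hq0 hqt (hts.le.trans hqs1)) (hVint t qstar ht0.le hts.le hqs1)
      linarith [hsurplus t hqt, le_value t ht0 (hts.le.trans hqs1)]
  · have hqpos : 0 < q := pos_of_mul_pos_left (hrev0.trans_lt (hRA.trans_lt hAk)) hk0.le
    have hint := integral_le_neg_mul_log hqpos hunder hqs1 hB (hVint q qstar hq0 hunder hqs1)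
      fun z hz => hrevenue z (hq0.trans hz.1.le) hz.2.le
        (hAk.trans (mul_lt_mul_of_pos_right hz.1 hk0))
    have hlog : Real.log q ≤ 0 := Real.log_nonpos hq0 hq1
    nlinarith [hsurplus q le_rfl, le_value q hqpos hq1,
      mul_nonneg (sub_nonneg.2 hAk.le) (neg_nonneg.2 hlog)]
end
end

section
/- The quantity s_α = sup{ q·(k_α − p) : q ∈ [0,1], p ∈ [0,k_α], (1−α)·q·k_α − q·p·log q > r_α } (the supremum of the empty set being 0) has the closed form: s_α = v̄·α/(2−α) if α ≤ 1/2, and s_α = r_α if α > 1/2. -/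
open Real Set MeasureTheory

noncomputable section

lemma sub_one_le_mul_log {q : ℝ} (hq : 0 ≤ q) : q - 1 ≤ q * Real.log q := by
  rcases hq.eq_or_lt with rfl | hq
  · simp
  · have h := mul_le_mul_of_nonneg_left (Real.one_sub_inv_le_log_of_pos hq) hq.le
    rwa [mul_sub, mul_one, mul_inv_cancel₀ hq.ne'] at h

lemma kcap_pos {vbar alpha : ℝ} (hv : 0 < vbar) (ha : alpha ≤ 1) : 0 < kcap vbar alpha :=
  div_pos hv (by linarith)

lemma bddAbove_regretFn {vbar alpha : ℝ} (hK : 0 < kcap vbar alpha) :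
    BddAbove { x | ∃ q ∈ Icc (0:ℝ) 1, ∃ p ∈ Icc (0:ℝ) (kcap vbar alpha),
      x = regretFn vbar alpha q p } := by
  refine ⟨kcap vbar alpha, ?_⟩
  rintro _ ⟨q, ⟨hq0, hq1⟩, p, ⟨hp0, hp1⟩, rfl⟩
  refine (min_le_right _ _).trans ?_
  nlinarith [mul_nonneg hq0 hp0]

lemma regretFn_le_rbound {vbar alpha q p : ℝ} (hK : 0 < kcap vbar alpha)
    (hq : q ∈ Icc (0:ℝ) 1) (hp : p ∈ Icc (0:ℝ) (kcap vbar alpha)) :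
    regretFn vbar alpha q p ≤ rbound vbar alpha :=
  le_csSup (bddAbove_regretFn hK) ⟨q, hq, p, hp, rfl⟩

lemma exists_regretFn_eq_rbound {vbar alpha : ℝ} (hK : 0 < kcap vbar alpha) :
    ∃ q ∈ Icc (0:ℝ) 1, ∃ p ∈ Icc (0:ℝ) (kcap vbar alpha),
      regretFn vbar alpha q p = rbound vbar alpha := by
  have hc : Continuous fun x : ℝ × ℝ => regretFn vbar alpha x.1 x.2 := by
    have h : Continuous fun x : ℝ × ℝ => x.1 * Real.log x.1 :=
      Real.continuous_mul_log.comp continuous_fst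
    have h' : (fun x : ℝ × ℝ => regretFn vbar alpha x.1 x.2) = fun x : ℝ × ℝ =>
        min ((1 - alpha) * x.1 * kcap vbar alpha - x.2 * (x.1 * Real.log x.1))
          (x.1 * (kcap vbar alpha - x.2)) := by
      funext x
      rw [regretFn, mul_comm x.1 x.2, mul_assoc x.2]
    rw [h']
    fun_prop
  obtain ⟨⟨q, p⟩, ⟨hq, hp⟩, hmax⟩ :=
    ((isCompact_Icc (a := (0:ℝ)) (b := 1)).prod
      (isCompact_Icc (a := (0:ℝ)) (b := kcap vbar alpha))).exists_isMaxOn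
      ⟨(0, 0), ⟨by simp, by simp [hK.le]⟩⟩ hc.continuousOn
  refine ⟨q, hq, p, hp, (regretFn_le_rbound hK hq hp).antisymm ?_⟩
  refine csSup_le ⟨_, q, hq, p, hp, rfl⟩ ?_
  rintro _ ⟨q', hq', p', hp', rfl⟩
  exact hmax (show (q', p') ∈ Icc (0:ℝ) 1 ×ˢ Icc (0:ℝ) (kcap vbar alpha) from ⟨hq', hp'⟩)

lemma bddAbove_sbound {vbar alpha : ℝ} (hK : 0 < kcap vbar alpha) (r : ℝ) :
    BddAbove { x | ∃ q ∈ Icc (0:ℝ) 1, ∃ p ∈ Icc (0:ℝ) (kcap vbar alpha),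
      (1 - alpha) * q * kcap vbar alpha - q * p * Real.log q > r ∧
        x = q * (kcap vbar alpha - p) } := by
  refine ⟨kcap vbar alpha, ?_⟩
  rintro _ ⟨q, ⟨hq0, hq1⟩, p, ⟨hp0, hp1⟩, -, rfl⟩
  nlinarith [mul_nonneg hq0 hp0]

/-- Just below `q = 1` there are points where the first term of `regretFn` exceeds `(1 - α) k_α`
while the second is as close to `α k_α` as we like. -/
lemma exists_first_term_gt {vbar alpha d : ℝ} (hK : 0 < kcap vbar alpha) (ha : alpha ≤ 1)
    (hd : 0 < d) (hda : 2 * d ≤ alpha) :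
    ∃ q ∈ Icc (0:ℝ) 1, ∃ p ∈ Icc (0:ℝ) (kcap vbar alpha),
      (1 - alpha) * kcap vbar alpha
        < (1 - alpha) * q * kcap vbar alpha - q * p * Real.log q ∧
      q * (kcap vbar alpha - p) = (alpha - 2 * d) * kcap vbar alpha := by
  have h1 : 0 < 1 - d := by linarith
  refine ⟨1 - d, ⟨h1.le, by linarith⟩, (1 - alpha + d) * kcap vbar alpha / (1 - d),
    ⟨div_nonneg (mul_nonneg (by linarith) hK.le) h1.le, ?_⟩, ?_, ?_⟩
  · rw [div_le_iff₀ h1, mul_comm]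
    exact mul_le_mul_of_nonneg_left (by linarith) hK.le
  · rw [mul_div_cancel₀ _ h1.ne']
    have hlog : Real.log (1 - d) ≤ -d := by
      linarith [Real.log_le_sub_one_of_pos h1]
    have hpos : 0 ≤ (1 - alpha + d) * kcap vbar alpha := mul_nonneg (by linarith) hK.le
    nlinarith [mul_le_mul_of_nonneg_left hlog hpos, mul_pos (mul_pos hd hd) hK]
  · rw [mul_sub, mul_div_cancel₀ _ h1.ne']
    ring

lemma rbound_eq_of_le_half_s16 {vbar alpha : ℝ} (hK : 0 < kcap vbar alpha) (ha : alpha ∈ Icc (0:ℝ) 1)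
    (h : alpha ≤ 1/2) : rbound vbar alpha = (1 - alpha) * kcap vbar alpha := by
  obtain ⟨ha0, ha1⟩ := ha
  refine le_antisymm (Real.sSup_le ?_ (mul_nonneg (by linarith) hK.le)) ?_
  · rintro _ ⟨q, ⟨hq0, hq1⟩, p, ⟨hp0, hp1⟩, rfl⟩
    rw [regretFn, min_le_iff, or_iff_not_imp_right, not_le]
    intro h2
    have hqa : 1 - alpha < q := by
      by_contra! hle
      nlinarith [mul_nonneg hq0 hp0]
    have hq : 0 < q := by linarith
    have hL : 0 ≤ -Real.log q := neg_nonneg.2 (Real.log_nonpos hq0 hq1)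
    have hqL : q * -Real.log q ≤ 1 - q := by linarith [sub_one_le_mul_log hq0]
    have h3 : q * p * -Real.log q ≤ (q - (1 - alpha)) * kcap vbar alpha * -Real.log q :=
      mul_le_mul_of_nonneg_right (by linarith) hL
    have h4 : (q - (1 - alpha)) * -Real.log q ≤ (1 - alpha) * (1 - q) := by
      have h5 : (q - (1 - alpha)) ≤ (1 - alpha) * q := by nlinarith
      calc _ ≤ (1 - alpha) * q * -Real.log q := mul_le_mul_of_nonneg_right h5 hL
        _ = (1 - alpha) * (q * -Real.log q) := by ring
        _ ≤ _ := mul_le_mul_of_nonneg_left hqL (by linarith)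
    nlinarith [mul_le_mul_of_nonneg_right h4 hK.le]
  · have h1 := regretFn_le_rbound (q := 1) (p := alpha * kcap vbar alpha) hK (by simp)
      ⟨mul_nonneg ha0 hK.le, by nlinarith⟩
    have h2 : regretFn vbar alpha 1 (alpha * kcap vbar alpha)
        = (1 - alpha) * kcap vbar alpha := by
      simp [regretFn, sub_mul]
    exact h2 ▸ h1

lemma sbound_eq_of_le_half {vbar alpha : ℝ} (hK : 0 < kcap vbar alpha) (ha : alpha ∈ Icc (0:ℝ) 1)
    (h : alpha ≤ 1/2) : sbound vbar alpha = alpha * kcap vbar alpha := by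
  have hr := rbound_eq_of_le_half_s16 hK ha h
  obtain ⟨ha0, ha1⟩ := ha
  refine le_antisymm (Real.sSup_le ?_ (mul_nonneg ha0 hK.le)) ?_
  · rintro _ ⟨q, ⟨hq0, hq1⟩, p, ⟨hp0, hp1⟩, hgt, rfl⟩
    rw [hr] at hgt
    have hp : (1 - alpha) * kcap vbar alpha < p := by
      by_contra! hle
      have h1 := mul_le_mul_of_nonneg_left (sub_one_le_mul_log hq0) hp0
      nlinarith [mul_le_mul_of_nonneg_right hle (sub_nonneg.2 hq1)]
    nlinarith [mul_le_mul_of_nonneg_right hq1 (sub_nonneg.2 hp1)]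
  · rcases ha0.eq_or_lt with rfl | hapos
    · rw [zero_mul]
      refine Real.sSup_nonneg ?_
      rintro _ ⟨q, ⟨hq0, -⟩, p, ⟨-, hp1⟩, -, rfl⟩
      exact mul_nonneg hq0 (sub_nonneg.2 hp1)
    · refine le_of_forall_lt fun c hc => ?_
      set d := min (alpha / 2) ((alpha - c / kcap vbar alpha) / 4)
      have hc' : c / kcap vbar alpha < alpha := by rwa [div_lt_iff₀ hK]
      have hdpos : 0 < d := lt_min (by linarith) (by linarith)
      have hd1 : d ≤ alpha / 2 := min_le_left _ _
      have hd2 : d ≤ (alpha - c / kcap vbar alpha) / 4 := min_le_right _ _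
      obtain ⟨q, hq, p, hp, hgt, heq⟩ := exists_first_term_gt hK ha1 hdpos (by linarith)
      refine lt_of_lt_of_le ?_ (le_csSup (bddAbove_sbound hK _) ⟨q, hq, p, hp, hr ▸ hgt, rfl⟩)
      rw [heq, ← div_lt_iff₀ hK]
      linarith

lemma lt_rbound_of_half_lt {vbar alpha : ℝ} (hK : 0 < kcap vbar alpha) (ha : alpha ≤ 1)
    (h : 1/2 < alpha) : (1 - alpha) * kcap vbar alpha < rbound vbar alpha := by
  obtain ⟨q, hq, p, hp, hgt, heq⟩ :=
    exists_first_term_gt (d := (2 * alpha - 1) / 4) hK ha (by linarith) (by linarith)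
  refine (lt_min hgt ?_).trans_le (regretFn_le_rbound hK hq hp)
  rw [heq]
  exact mul_lt_mul_of_pos_right (by linarith) hK

lemma sbound_eq_rbound_of_half_lt {vbar alpha : ℝ} (hK : 0 < kcap vbar alpha) (ha : alpha ≤ 1)
    (h : 1/2 < alpha) : sbound vbar alpha = rbound vbar alpha := by
  have hlt := lt_rbound_of_half_lt hK ha h
  have hr0 : 0 < rbound vbar alpha := (mul_nonneg (by linarith) hK.le).trans_lt hlt
  refine le_antisymm (Real.sSup_le ?_ hr0.le) ?_
  · rintro _ ⟨q, hq, p, hp, hgt, rfl⟩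
    by_contra! hgt'
    exact (lt_min hgt hgt').not_ge (regretFn_le_rbound hK hq hp)
  · obtain ⟨q, ⟨hq0, hq1⟩, p, ⟨hp0, hp1⟩, heq⟩ := exists_regretFn_eq_rbound hK
    have h1 : rbound vbar alpha ≤ (1 - alpha) * q * kcap vbar alpha - q * p * Real.log q :=
      heq ▸ min_le_left _ _
    have h2 : rbound vbar alpha ≤ q * (kcap vbar alpha - p) := heq ▸ min_le_right _ _
    have hqpos : 0 < q := hq0.lt_of_ne fun h0 => by
      rw [← h0, zero_mul] at h2
      linarith
    have hq_lt : q < 1 := hq1.lt_of_ne fun h0 => by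
      rw [h0, Real.log_one] at h1
      linarith
    have hp_lt : p < kcap vbar alpha := by
      by_contra! hle
      nlinarith
    have hlog : q * Real.log q < 0 := mul_neg_of_pos_of_neg hqpos (Real.log_neg hqpos hq_lt)
    refine le_of_forall_lt fun c hc => ?_
    obtain ⟨e, he, he'⟩ := exists_between
      (lt_min (sub_pos.2 hp_lt) (sub_pos.2 hc))
    obtain ⟨he1, he2⟩ := lt_min_iff.1 he'
    refine lt_of_lt_of_le ?_ (le_csSup (bddAbove_sbound hK _)
      ⟨q, ⟨hq0, hq1⟩, p + e, ⟨by linarith, by linarith⟩, ?_, rfl⟩)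
    · nlinarith
    · nlinarith [mul_neg_of_pos_of_neg he hlog]

/-- Closed form for `s_alpha`: it equals `vbar * alpha / (2 - alpha)` when
`alpha ≤ 1/2`, and equals `r_alpha` when `alpha > 1/2`. -/
theorem sbound_closed_form
    (vbar alpha : ℝ) (hv : 0 < vbar) (halpha : alpha ∈ Icc (0:ℝ) 1) :
    (alpha ≤ 1/2 → sbound vbar alpha = vbar * alpha / (2 - alpha)) ∧
      (1/2 < alpha → sbound vbar alpha = rbound vbar alpha) := by
  have hK := kcap_pos hv halpha.2
  refine ⟨fun h => ?_, sbound_eq_rbound_of_half_lt hK halpha.2⟩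
  rw [sbound_eq_of_le_half hK halpha h, kcap]
  ring
end
end
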